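/- If two continuous curves in the closed square each join two boundary points, and the endpoints of the second curve lie in different connected components of the boundary minus the endpoints of the first curve, and the first curve meets the boundary only at its endpoints, then the two curves intersect. -/

import Mathlib

open Set Complex

/-- The argument of the chord from `exp (θ * I)` to `1`. -/
theorem arg_one_sub_exp_mul_I {θ : ℝ} (h₀ : 0 < θ) (h₁ : θ < 2 * Real.pi) :
    (1 - exp (θ * I)).arg = (θ - Real.pi) / 2 := by
  have hs : 0 < 2 * Real.sin (θ / 2) := by
    have := Real.sin_pos_of_pos_of_lt_pi (x := θ / 2) (by linarith) (by linarith)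
    linarith
  have key : 1 - exp (θ * I) = (2 * Real.sin (θ / 2) : ℝ) *
      (Complex.cos ((θ - Real.pi) / 2 : ℝ) + Complex.sin ((θ - Real.pi) / 2 : ℝ) * I) := by
    rw [show (θ - Real.pi) / 2 = θ / 2 - Real.pi / 2 by ring, ← ofReal_cos, ← ofReal_sin,
      Real.cos_sub_pi_div_two, Real.sin_sub_pi_div_two, exp_mul_I, ← ofReal_cos, ← ofReal_sin]
    have hc := Real.cos_sq' (θ / 2)
    have h2 := Real.cos_two_mul (θ / 2)
    have h3 := Real.sin_two_mul (θ / 2)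
    rw [show 2 * (θ / 2) = θ by ring] at h2 h3
    apply Complex.ext
    · simp only [sub_re, one_re, add_re, mul_re, ofReal_re, ofReal_im, I_re, I_im, add_im, mul_im]
      nlinarith
    · simp only [sub_im, one_im, add_re, mul_re, ofReal_re, ofReal_im, I_re, I_im, add_im, mul_im]
      nlinarith
  rw [key, arg_mul_cos_add_sin_mul_I hs ⟨by linarith, by linarith⟩]

theorem arg_one_sub_exp_mul_I_of_neg {θ : ℝ} (h₀ : -(2 * Real.pi) < θ) (h₁ : θ < 0) :
    (1 - exp (θ * I)).arg = (θ + Real.pi) / 2 := by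
  have h := arg_one_sub_exp_mul_I (θ := θ + 2 * Real.pi) (by linarith) (by linarith)
  have e : exp ((θ + 2 * Real.pi : ℝ) * I) = exp (θ * I) := by
    rw [← exp_periodic (θ * I)]
    push_cast
    ring_nf
  rw [e] at h
  rw [h]
  ring

theorem one_sub_mem_slitPlane {w : ℂ} (hw : ‖w‖ ≤ 1) (hw1 : w ≠ 1) : 1 - w ∈ slitPlane := by
  left
  rw [sub_re, one_re, sub_pos]
  refine lt_of_le_of_ne ((re_le_norm w).trans hw) fun h ↦ hw1 ?_
  have h1 : w.re * w.re + w.im * w.im ≤ 1 := by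
    rw [← normSq_apply, normSq_eq_norm_sq]
    nlinarith [norm_nonneg w]
  refine Complex.ext h ?_
  rw [h] at h1
  have : w.im * w.im = 0 := by nlinarith [mul_self_nonneg w.im]
  simpa using this

/-- Two continuous functions on a preconnected space whose exponentials agree up to a constant
factor differ by a constant. -/
theorem sub_eq_sub_of_exp_eq_mul_exp {X : Type*} [TopologicalSpace X] [PreconnectedSpace X]
    {L M : X → ℂ} (hL : Continuous L) (hM : Continuous M) {c : ℂ}
    (h : ∀ x, exp (L x) = c * exp (M x)) (x y : X) : L x - L y = M x - M y := by
  have := isCoveringMap_exp.eq_of_comp_eq (g₁ := fun x ↦ L x - M x) (g₂ := fun _ ↦ L y - M y)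
    (by fun_prop) (by fun_prop) (by
      funext z
      apply Subtype.ext
      simp only [Function.comp_apply, exp_sub, h]
      rw [mul_div_cancel_right₀ _ (exp_ne_zero _), mul_div_cancel_right₀ _ (exp_ne_zero _)]) y rfl
  have := congrFun this x
  linear_combination this

/-- Variation of a continuous logarithm of `exp (θ * I) - w` (up to a constant factor) along a
path `w` in the closed unit disc. -/
theorem im_log_variation {L w : ℝ → ℂ} (hL : Continuous L) (hw : Continuous w)
    (hw1 : ∀ t, ‖w t‖ ≤ 1) {c : ℂ} {θ φ ψ : ℝ} (hne : ∀ t, w t ≠ exp (θ * I))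
    (h : ∀ t, exp (L t) = c * (exp (θ * I) - w t))
    (h₀ : w 0 = exp (φ * I)) (h₁ : w 1 = exp (ψ * I)) :
    (L 1).im - (L 0).im =
      (1 - exp ((ψ - θ : ℝ) * I)).arg - (1 - exp ((φ - θ : ℝ) * I)).arg := by
  have hs : ∀ t, 1 - w t / exp (θ * I) ∈ slitPlane := fun t ↦
    one_sub_mem_slitPlane (by rw [norm_div, norm_exp_ofReal_mul_I, div_one]; exact hw1 t)
      fun he ↦ hne t (by rwa [div_eq_one_iff_eq (exp_ne_zero _)] at he)
  have hv := sub_eq_sub_of_exp_eq_mul_exp (L := L) (M := fun t ↦ log (1 - w t / exp (θ * I)))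
    (c := c * exp (θ * I)) hL
    (Continuous.clog (continuous_const.sub (hw.div_const _)) hs) (fun t ↦ by
      rw [exp_log (slitPlane_ne_zero (hs t)), h]
      field_simp [exp_ne_zero]) 1 0
  have := congrArg im hv
  simp only [sub_im, log_im, h₀, h₁, ← exp_sub] at this
  rw [this]
  push_cast
  simp only [sub_mul]

/-- Two paths in the closed unit disc whose endpoints alternate on the unit circle meet. -/
theorem exists_eq_of_alternating_endpoints {f g : ℝ → ℂ} (hf : Continuous f) (hg : Continuous g)
    (hf1 : ∀ s, ‖f s‖ ≤ 1) (hg1 : ∀ t, ‖g t‖ ≤ 1) {α β χ δ : ℝ}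
    (hf₀ : f 0 = exp (α * I)) (hf₁ : f 1 = exp (β * I))
    (hg₀ : g 0 = exp (χ * I)) (hg₁ : g 1 = exp (δ * I))
    (h₁ : α < χ) (h₂ : χ < β) (h₃ : β < δ) (h₄ : δ < α + 2 * Real.pi) :
    ∃ s t, f s = g t := by
  by_contra! hne
  obtain ⟨L, hL, hexp⟩ := exists_continuousOn_eqOn_exp_comp (X := ℝ × ℝ) (U := univ)
    (g := fun p ↦ f p.1 - g p.2)
    (Homeomorph.Set.univ (ℝ × ℝ)).toHomotopyEquiv.simplyConnectedSpace isOpen_univ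
    (by fun_prop) (by
      rintro ⟨p, -, hp⟩
      exact hne p.1 p.2 (sub_eq_zero.1 hp))
  rw [continuousOn_univ] at hL
  have hE : ∀ s t, exp (L (s, t)) = f s - g t := fun s t ↦ hexp (mem_univ (s, t))
  have e₁ := im_log_variation (L := fun t ↦ L (0, t)) (by fun_prop) hg hg1 (c := 1)
    (fun t ↦ hf₀ ▸ (hne 0 t).symm) (fun t ↦ by rw [hE, hf₀, one_mul]) hg₀ hg₁
  have e₂ := im_log_variation (L := fun t ↦ L (1, t)) (by fun_prop) hg hg1 (c := 1)
    (fun t ↦ hf₁ ▸ (hne 1 t).symm) (fun t ↦ by rw [hE, hf₁, one_mul]) hg₀ hg₁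
  have e₃ := im_log_variation (L := fun s ↦ L (s, 0)) (by fun_prop) hf hf1 (c := -1)
    (fun s ↦ hg₀ ▸ hne s 0) (fun s ↦ by rw [hE, hg₀]; ring) hf₀ hf₁
  have e₄ := im_log_variation (L := fun s ↦ L (s, 1)) (by fun_prop) hf hf1 (c := -1)
    (fun s ↦ hg₁ ▸ hne s 1) (fun s ↦ by rw [hE, hg₁]; ring) hf₀ hf₁
  rw [arg_one_sub_exp_mul_I (by linarith) (by linarith),
    arg_one_sub_exp_mul_I (by linarith) (by linarith)] at e₁
  rw [arg_one_sub_exp_mul_I (by linarith) (by linarith),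
    arg_one_sub_exp_mul_I_of_neg (by linarith) (by linarith)] at e₂
  rw [arg_one_sub_exp_mul_I (by linarith) (by linarith),
    arg_one_sub_exp_mul_I_of_neg (by linarith) (by linarith)] at e₃
  rw [arg_one_sub_exp_mul_I_of_neg (by linarith) (by linarith),
    arg_one_sub_exp_mul_I_of_neg (by linarith) (by linarith)] at e₄
  linarith [Real.pi_pos]

theorem exists_exp_mul_I_eq_of_mem_Ioo {z : ℂ} {α : ℝ} (hz : ‖z‖ = 1) (hne : z ≠ exp (α * I)) :
    ∃ θ ∈ Ioo α (α + 2 * Real.pi), exp (θ * I) = z := by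
  set θ := toIcoMod Real.two_pi_pos α z.arg with hθ
  have hexp : exp (θ * I) = z := by
    have hz' := norm_mul_exp_arg_mul_I z
    rw [hz, ofReal_one, one_mul] at hz'
    conv_rhs => rw [← hz']
    rw [exp_eq_exp_iff_exists_int]
    refine ⟨-toIcoDiv Real.two_pi_pos α z.arg, ?_⟩
    rw [hθ, ← self_sub_toIcoDiv_zsmul]
    rw [zsmul_eq_mul]
    push_cast
    ring
  have hmem := toIcoMod_mem_Ico Real.two_pi_pos α z.arg
  rw [← hθ] at hmem
  refine ⟨θ, ⟨lt_of_le_of_ne hmem.1 ?_, hmem.2⟩, hexp⟩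
  intro he
  exact hne (by rw [he, hexp])

/-- A homeomorphism of the unit square onto the closed unit disc. -/
theorem exists_homeomorph_image_Icc_eq_closedBall :
    ∃ h : (ℝ × ℝ) ≃ₜ ℂ, h '' Icc (0, 0) (1, 1) = Metric.closedBall 0 1 ∧
      h '' frontier (Icc (0, 0) (1, 1)) = Metric.sphere 0 1 := by
  let e := Complex.equivRealProdCLM.symm
  have hQ : IsClosed (e '' Icc (0, 0) (1, 1)) :=
    e.toHomeomorph.isClosedMap _ isClosed_Icc
  obtain ⟨h, -, hc, hf⟩ := exists_homeomorph_image_interior_closure_frontier_eq_unitBall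
    (s := e '' Icc (0, 0) (1, 1)) ((convex_Icc _ _).linear_image e.toLinearMap)
    (by
      rw [← e.coe_toHomeomorph, ← e.toHomeomorph.image_interior, Icc_prod_eq, interior_prod_eq]
      simp)
    (e.lipschitz.isBounded_image (Metric.isBounded_Icc _ _))
  refine ⟨e.toHomeomorph.trans h, ?_, ?_⟩
  · rw [hQ.closure_eq] at hc
    rw [← hc, image_image]
    rfl
  · rw [← hf, ← e.coe_toHomeomorph, ← e.toHomeomorph.image_frontier, image_image]
    rfl

theorem connectedComponentIn_eq_of_mem_Ioo {h : (ℝ × ℝ) ≃ₜ ℂ} {S : Set (ℝ × ℝ)}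
    (hS : h '' S = Metric.sphere 0 1) {a b c d : ℝ × ℝ} {α β χ δ l u : ℝ}
    (ha : h a = exp (α * I)) (hb : h b = exp (β * I))
    (hc : h c = exp (χ * I)) (hd : h d = exp (δ * I)) (hχ : χ ∈ Ioo l u) (hδ : δ ∈ Ioo l u)
    (hα : ∀ θ ∈ Ioo l u, exp (θ * I) ≠ exp (α * I))
    (hβ : ∀ θ ∈ Ioo l u, exp (θ * I) ≠ exp (β * I)) :
    connectedComponentIn (S \ {a, b}) c = connectedComponentIn (S \ {a, b}) d := by
  let P : ℝ → ℝ × ℝ := fun θ ↦ h.symm (exp (θ * I))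
  have hP : Continuous P := h.symm.continuous.comp (by fun_prop)
  have hconn : IsPreconnected (P '' Ioo l u) := isPreconnected_Ioo.image _ hP.continuousOn
  have hsub : P '' Ioo l u ⊆ S \ {a, b} := by
    rintro _ ⟨θ, hθ, rfl⟩
    refine ⟨?_, ?_⟩
    · have : exp (θ * I) ∈ h '' S := by simp [hS]
      obtain ⟨p, hp, he⟩ := this
      simpa [P, ← he] using hp
    · rintro (he | he)
      · exact hα θ hθ (by rw [← ha, ← he]; simp [P])
      · exact hβ θ hθ (by rw [← hb, ← (show P θ = b from he)]; simp [P])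
  have hPc : P χ = c := by simp [P, ← hc]
  have hPd : P δ = d := by simp [P, ← hd]
  refine connectedComponentIn_eq (hconn.subset_connectedComponentIn ⟨χ, hχ, hPc⟩ hsub ⟨δ, hδ, hPd⟩)

theorem exp_ofReal_mul_I_ne {θ φ : ℝ} (h₁ : θ ≠ φ) (h₂ : |θ - φ| < 2 * Real.pi) :
    exp (θ * I) ≠ exp (φ * I) := by
  rw [Ne, exp_eq_exp_iff_exists_int]
  rintro ⟨n, hn⟩
  have h : θ - φ = n * (2 * Real.pi) := by
    have := congrArg im hn
    simp at this
    linarith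
  rw [h, abs_mul, abs_of_pos Real.two_pi_pos, mul_lt_iff_lt_one_left Real.two_pi_pos] at h₂
  have hn0 : n = 0 := Int.abs_lt_one_iff.1 (by exact_mod_cast h₂)
  rw [hn0, Int.cast_zero, zero_mul, sub_eq_zero] at h
  exact h₁ h


/-- Topological crossing: if two continuous curves in the closed unit square each join
two boundary points, all four endpoints distinct, the first curve meets the boundary only
at its endpoints, and the endpoints of the second curve lie in different connected
components of the boundary minus the endpoints of the first, then the curves intersect. -/
theorem stmt16 (γ γ' : ℝ → ℝ × ℝ)
    (hγ : ContinuousOn γ (Set.Icc 0 1)) (hγ' : ContinuousOn γ' (Set.Icc 0 1))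
    (Q : Set (ℝ × ℝ)) (hQ : Q = Set.Icc ((0 : ℝ), (0 : ℝ)) (1, 1))
    (hmapγ : Set.MapsTo γ (Set.Icc 0 1) Q) (hmapγ' : Set.MapsTo γ' (Set.Icc 0 1) Q)
    (hb : γ 0 ∈ frontier Q ∧ γ 1 ∈ frontier Q ∧ γ' 0 ∈ frontier Q ∧ γ' 1 ∈ frontier Q)
    (hdistinct : [γ 0, γ 1, γ' 0, γ' 1].Pairwise (· ≠ ·))
    (hint : γ '' Set.Ioo 0 1 ⊆ interior Q)
    (hsep : connectedComponentIn (frontier Q \ {γ 0, γ 1}) (γ' 0) ≠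
      connectedComponentIn (frontier Q \ {γ 0, γ 1}) (γ' 1)) :
    ∃ s ∈ Set.Icc (0 : ℝ) 1, ∃ t ∈ Set.Icc (0 : ℝ) 1, γ s = γ' t := by
  subst hQ
  obtain ⟨h, hcl, hfr⟩ := exists_homeomorph_image_Icc_eq_closedBall
  have hdisc : ∀ p ∈ Icc ((0 : ℝ), (0 : ℝ)) (1, 1), ‖h p‖ ≤ 1 := fun p hp ↦ by
    have := mem_image_of_mem h hp
    rw [hcl] at this
    simpa using this
  have hcirc : ∀ p ∈ frontier (Icc ((0 : ℝ), (0 : ℝ)) (1, 1)), ‖h p‖ = 1 := fun p hp ↦ by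
    have := mem_image_of_mem h hp
    rw [hfr] at this
    simpa using this
  obtain ⟨ha, hb, hc, hd⟩ := hb
  simp only [List.pairwise_cons, List.mem_cons, List.not_mem_nil, or_false, forall_eq_or_imp,
    forall_eq] at hdistinct
  obtain ⟨⟨hab, hac, had⟩, ⟨hbc, hbd⟩, -⟩ := hdistinct
  obtain ⟨α, hα⟩ : ∃ α : ℝ, h (γ 0) = exp (α * I) :=
    ⟨(h (γ 0)).arg, by
      have := norm_mul_exp_arg_mul_I (h (γ 0))
      rw [hcirc _ ha, ofReal_one, one_mul] at this
      exact this.symm⟩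
  have lift : ∀ p ∈ frontier (Icc ((0 : ℝ), (0 : ℝ)) (1, 1)), γ 0 ≠ p →
      ∃ θ ∈ Ioo α (α + 2 * Real.pi), exp (θ * I) = h p := fun p hp hne ↦
    exists_exp_mul_I_eq_of_mem_Ioo (hcirc p hp) (hα ▸ h.injective.ne hne.symm)
  obtain ⟨β, ⟨hβ₁, hβ₂⟩, hβ⟩ := lift _ hb hab
  obtain ⟨χ, ⟨hχ₁, hχ₂⟩, hχ⟩ := lift _ hc hac
  obtain ⟨δ, ⟨hδ₁, hδ₂⟩, hδ⟩ := lift _ hd had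
  have hχβ : χ ≠ β := by
    rintro rfl
    exact hbc (h.injective (hβ.symm.trans hχ))
  have hδβ : δ ≠ β := by
    rintro rfl
    exact hbd (h.injective (hβ.symm.trans hδ))
  have hf : Continuous fun s ↦ h (γ (projIcc (0 : ℝ) 1 zero_le_one s)) :=
    h.continuous.comp (hγ.comp_continuous (by fun_prop) fun s ↦ (projIcc _ _ _ s).2)
  have hg : Continuous fun t ↦ h (γ' (projIcc (0 : ℝ) 1 zero_le_one t)) :=
    h.continuous.comp (hγ'.comp_continuous (by fun_prop) fun s ↦ (projIcc _ _ _ s).2)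
  have hf1 := fun s ↦ hdisc _ (hmapγ (projIcc (0 : ℝ) 1 zero_le_one s).2)
  have hg1 := fun t ↦ hdisc _ (hmapγ' (projIcc (0 : ℝ) 1 zero_le_one t).2)
  rcases lt_or_gt_of_ne hχβ with hχβ | hχβ <;> rcases lt_or_gt_of_ne hδβ with hδβ | hδβ
  · exact absurd (connectedComponentIn_eq_of_mem_Ioo hfr hα hβ.symm hχ.symm hδ.symm
      ⟨hχ₁, hχβ⟩ ⟨hδ₁, hδβ⟩
      (fun θ hθ ↦ exp_ofReal_mul_I_ne hθ.1.ne' (abs_lt.2 ⟨by linarith [hθ.1], by linarith [hθ.2]⟩))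
      (fun θ hθ ↦ exp_ofReal_mul_I_ne hθ.2.ne (abs_lt.2 ⟨by linarith [hθ.1], by linarith [hθ.2]⟩)))
      hsep
  · obtain ⟨s, t, hst⟩ := exists_eq_of_alternating_endpoints hf hg hf1 hg1
      (by simpa using hα) (by simpa using hβ.symm) (by simpa using hχ.symm) (by simpa using hδ.symm)
      hχ₁ hχβ hδβ hδ₂
    exact ⟨_, (projIcc _ _ _ s).2, _, (projIcc _ _ _ t).2, h.injective hst⟩
  · obtain ⟨s, t, hst⟩ := exists_eq_of_alternating_endpoints hf
      (hg.comp (continuous_const.sub continuous_id : Continuous fun t : ℝ ↦ 1 - t))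
      hf1 (fun t ↦ hg1 (1 - t))
      (by simpa using hα) (by simpa using hβ.symm) (by simpa using hδ.symm) (by simpa using hχ.symm)
      hδ₁ hδβ hχβ hχ₂
    exact ⟨_, (projIcc _ _ _ s).2, _, (projIcc _ _ _ (1 - t)).2, h.injective hst⟩
  · exact absurd (connectedComponentIn_eq_of_mem_Ioo hfr hα hβ.symm hχ.symm hδ.symm
      ⟨hχβ, hχ₂⟩ ⟨hδβ, hδ₂⟩
      (fun θ hθ ↦ exp_ofReal_mul_I_ne (by linarith [hθ.1])
        (abs_lt.2 ⟨by linarith [hθ.1], by linarith [hθ.2]⟩))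
      (fun θ hθ ↦ exp_ofReal_mul_I_ne hθ.1.ne' (abs_lt.2 ⟨by linarith [hθ.1], by linarith [hθ.2]⟩)))
      hsep
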